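/- Fix w > 0 and c ≥ 0. The function r ↦ erf((c - 2r)/(√2 w)) + erf((c + 2r)/(√2 w)) is antitone (nonincreasing) on [0, ∞): for all 0 ≤ r₁ ≤ r₂, erf((c - 2r₂)/(√2 w)) + erf((c + 2r₂)/(√2 w)) ≤ erf((c - 2r₁)/(√2 w)) + erf((c + 2r₁)/(√2 w)). Consequently, the approximate blockage coefficient h_b^{(1)}(r) = (erf(√2 α/w))² - (1/2) erf(c/(√2 w)) ( erf((c - 2r)/(√2 w)) + erf((c + 2r)/(√2 w)) ), with c = a_b √π and any α > 0, a_b > 0, is monotone nondecreasing in r on [0, ∞). -/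

import Mathlib

open Real MeasureTheory intervalIntegral

/-- The error function `erf x = (2/√π) ∫_0^x exp(-t²) dt`. -/
noncomputable def erf (x : ℝ) : ℝ :=
  (2 / Real.sqrt Real.pi) * ∫ t in (0:ℝ)..x, Real.exp (-t ^ 2)

theorem hasDerivAt_erf (x : ℝ) :
    HasDerivAt erf (2 / Real.sqrt Real.pi * Real.exp (-x ^ 2)) x := by
  have hcont : Continuous fun t : ℝ => Real.exp (-t ^ 2) := by fun_prop
  exact (hcont.integral_hasStrictDerivAt 0 x).hasDerivAt.const_mul _

theorem erf_nonneg {x : ℝ} (hx : 0 ≤ x) : 0 ≤ erf x :=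
  mul_nonneg (by positivity)
    (intervalIntegral.integral_nonneg hx fun t _ => (Real.exp_pos _).le)

/-- Moving two symmetric evaluation points away from a nonnegative centre decreases the sum of
the values of `erf`. -/
theorem antitoneOn_erf_sub_add_erf_add {a : ℝ} (ha : 0 ≤ a) :
    AntitoneOn (fun u => erf (a - u) + erf (a + u)) (Set.Ici 0) := by
  have hderiv (u : ℝ) : HasDerivAt (fun u => erf (a - u) + erf (a + u))
      (2 / Real.sqrt Real.pi * Real.exp (-(a - u) ^ 2) * (-1) +
        2 / Real.sqrt Real.pi * Real.exp (-(a + u) ^ 2) * 1) u :=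
    ((hasDerivAt_erf (a - u)).comp u ((hasDerivAt_id u).const_sub a)).add
      ((hasDerivAt_erf (a + u)).comp u ((hasDerivAt_id u).const_add a))
  refine antitoneOn_of_deriv_nonpos (convex_Ici 0)
    (fun u _ => (hderiv u).continuousAt.continuousWithinAt)
    (fun u _ => (hderiv u).differentiableAt.differentiableWithinAt) fun u hu => ?_
  rw [interior_Ici, Set.mem_Ioi] at hu
  rw [(hderiv u).deriv]
  have hexp : Real.exp (-(a + u) ^ 2) ≤ Real.exp (-(a - u) ^ 2) :=
    Real.exp_le_exp.mpr (by nlinarith [mul_nonneg ha hu.le])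
  have hmul := mul_le_mul_of_nonneg_left hexp (by positivity : 0 ≤ 2 / Real.sqrt Real.pi)
  linarith

theorem stmt_9 (w c : ℝ) (hw : 0 < w) (hc : 0 ≤ c) :
    (∀ r₁ r₂ : ℝ, 0 ≤ r₁ → r₁ ≤ r₂ →
      erf ((c - 2 * r₂) / (Real.sqrt 2 * w)) + erf ((c + 2 * r₂) / (Real.sqrt 2 * w)) ≤
        erf ((c - 2 * r₁) / (Real.sqrt 2 * w)) + erf ((c + 2 * r₁) / (Real.sqrt 2 * w))) ∧
    ∀ (α ab : ℝ), 0 < α → 0 < ab → c = ab * Real.sqrt Real.pi →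
      MonotoneOn (fun r : ℝ =>
        (erf (Real.sqrt 2 * α / w)) ^ 2 -
          (1 / 2) * erf (c / (Real.sqrt 2 * w)) *
            (erf ((c - 2 * r) / (Real.sqrt 2 * w)) + erf ((c + 2 * r) / (Real.sqrt 2 * w))))
        (Set.Ici (0 : ℝ)) := by
  have hd : 0 < Real.sqrt 2 * w := by positivity
  have hanti : ∀ r₁ r₂ : ℝ, 0 ≤ r₁ → r₁ ≤ r₂ →
      erf ((c - 2 * r₂) / (Real.sqrt 2 * w)) + erf ((c + 2 * r₂) / (Real.sqrt 2 * w)) ≤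
        erf ((c - 2 * r₁) / (Real.sqrt 2 * w)) + erf ((c + 2 * r₁) / (Real.sqrt 2 * w)) := by
    intro r₁ r₂ h₁ h₁₂
    simp only [sub_div, add_div]
    have h₂ : 0 ≤ r₂ := h₁.trans h₁₂
    exact antitoneOn_erf_sub_add_erf_add (div_nonneg hc hd.le)
      (Set.mem_Ici.mpr (by positivity)) (Set.mem_Ici.mpr (by positivity)) (by gcongr)
  refine ⟨hanti, fun α ab _ _ _ r₁ h₁ r₂ _ h₁₂ => ?_⟩
  have hcoef : 0 ≤ 1 / 2 * erf (c / (Real.sqrt 2 * w)) :=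
    mul_nonneg (by norm_num) (erf_nonneg (div_nonneg hc hd.le))
  exact sub_le_sub_left (mul_le_mul_of_nonneg_left (hanti r₁ r₂ h₁ h₁₂) hcoef) _
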